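/- Let the cost Assumption hold and let G_i = {g_{i,1},...,g_{i,m_i}} be finite sets of μ_i-integrable Borel functions, with m := Σ_i m_i and g, ḡ, C as in the LSIP setup. Suppose there exists at least one (y_0,y) ∈ ℝ×ℝ^m with y_0 + ⟨g(x),y⟩ ≤ f(x) for all x ∈ X, and suppose the convex cone C := cone({(1, g(x)^T, f(x))^T : x ∈ X}) ⊆ ℝ^{m+2} is closed. Then strong duality holds: sup{ y_0 + ⟨ḡ,y⟩ : y_0 + ⟨g(x),y⟩ ≤ f(x) ∀x ∈ X } = inf{ ∫_X f dμ : μ ∈ Γ([μ_1]_{G_1},...,[μ_N]_{G_N}) }. -/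

import Mathlib

open MeasureTheory

noncomputable section

/-- A Borel measure on a metric space has a finite first moment, i.e. it belongs to `P_1`. -/
def HasFiniteFirstMoment {Y : Type*} [MeasurableSpace Y] [PseudoMetricSpace Y]
    (μ : Measure Y) : Prop :=
  ∃ y₀ : Y, Integrable (fun y => dist y₀ y) μ

/-- The moment set `[μ]_G`. -/
def MomentSet {Y : Type*} [MeasurableSpace Y] [PseudoMetricSpace Y]
    (μ : Measure Y) (G : Set (Y → ℝ)) : Set (Measure Y) :=
  {ν | IsProbabilityMeasure ν ∧ HasFiniteFirstMoment ν ∧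
    ∀ g ∈ G, Integrable g ν ∧ (∫ y, g y ∂ν) = ∫ y, g y ∂μ}

/-- `γ ∈ Γ([μ_1]_{G_1}, …, [μ_N]_{G_N})`. -/
def IsRelaxedCoupling {N : ℕ} {X : Fin N → Type*} [∀ i, MeasurableSpace (X i)]
    [∀ i, MetricSpace (X i)]
    (γ : Measure (∀ i, X i)) (μ : ∀ i, Measure (X i)) (G : ∀ i, Set (X i → ℝ)) : Prop :=
  IsProbabilityMeasure γ ∧ ∀ i, γ.map (fun x => x i) ∈ MomentSet (μ i) (G i)

/-- The set of values `∫ f dγ` over `γ ∈ S` for which `f` is integrable. -/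
def OTValues {A : Type*} [MeasurableSpace A] (f : A → ℝ) (S : Set (Measure A)) : Set ℝ :=
  {r : ℝ | ∃ γ ∈ S, Integrable f γ ∧ (∫ x, f x ∂γ) = r}

/-- The vector of test functions `g(x) ∈ ℝ^m`, `m = Σ_i m_i`, indexed by pairs `(i, j)`. -/
def gvec {N : ℕ} {X : Fin N → Type*} (m : Fin N → ℕ) (g : ∀ i, Fin (m i) → X i → ℝ)
    (x : ∀ i, X i) : ((i : Fin N) × Fin (m i)) → ℝ :=
  fun p => g p.1 p.2 (x p.1)

/-- The vector `ḡ ∈ ℝ^m` with entries `∫ g_{i,j} dμ_i`. -/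
def gbar {N : ℕ} {X : Fin N → Type*} [∀ i, MeasurableSpace (X i)] (m : Fin N → ℕ)
    (g : ∀ i, Fin (m i) → X i → ℝ) (μ : ∀ i, Measure (X i)) :
    ((i : Fin N) × Fin (m i)) → ℝ :=
  fun p => ∫ t, g p.1 p.2 t ∂(μ p.1)

/-- `(y₀, y)` is feasible for the dual LSIP problem:
`y₀ + ⟨g(x), y⟩ ≤ f(x)` for all `x ∈ X`. -/
def DualFeasible {N : ℕ} {X : Fin N → Type*} (m : Fin N → ℕ)
    (g : ∀ i, Fin (m i) → X i → ℝ) (f : (∀ i, X i) → ℝ)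
    (y₀ : ℝ) (y : ((i : Fin N) × Fin (m i)) → ℝ) : Prop :=
  ∀ x : ∀ i, X i, y₀ + ∑ p, gvec m g x p * y p ≤ f x

/-- The conic hull of a set: all finite nonnegative linear combinations of its elements. -/
def ConicHull {V : Type*} [AddCommMonoid V] [Module ℝ V] (s : Set V) : Set V :=
  {v | ∃ (k : ℕ) (c : Fin k → ℝ) (z : Fin k → V),
    (∀ j, 0 ≤ c j) ∧ (∀ j, z j ∈ s) ∧ v = ∑ j, c j • z j}

theorem zero_mem_conicHull {V : Type*} [AddCommMonoid V] [Module ℝ V] (s : Set V) :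
    (0 : V) ∈ ConicHull s :=
  ⟨0, Fin.elim0, Fin.elim0, fun j => j.elim0, fun j => j.elim0, by simp⟩

theorem subset_conicHull {V : Type*} [AddCommMonoid V] [Module ℝ V] (s : Set V) :
    s ⊆ ConicHull s :=
  fun v hv => ⟨1, fun _ => 1, fun _ => v, fun _ => zero_le_one, fun _ => hv, by simp⟩

theorem smul_mem_conicHull {V : Type*} [AddCommMonoid V] [Module ℝ V] {s : Set V} {a : ℝ}
    (ha : 0 ≤ a) {v : V} (hv : v ∈ ConicHull s) : a • v ∈ ConicHull s := by
  obtain ⟨k, c, z, hc, hz, rfl⟩ := hv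
  exact ⟨k, fun j => a * c j, z, fun j => mul_nonneg ha (hc j), hz,
    by simp [Finset.smul_sum, mul_smul]⟩

theorem add_mem_conicHull {V : Type*} [AddCommMonoid V] [Module ℝ V] {s : Set V}
    {v w : V} (hv : v ∈ ConicHull s) (hw : w ∈ ConicHull s) : v + w ∈ ConicHull s := by
  obtain ⟨k, c, z, hc, hz, rfl⟩ := hv
  obtain ⟨l, d, y, hd, hy, rfl⟩ := hw
  refine ⟨k + l, Fin.append c d, Fin.append z y, fun j => ?_, fun j => ?_, ?_⟩
  · refine Fin.addCases (fun i => ?_) (fun i => ?_) j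
    · simpa using hc i
    · simpa using hd i
  · refine Fin.addCases (fun i => ?_) (fun i => ?_) j
    · simpa using hz i
    · simpa using hy i
  · simp [Fin.sum_univ_add]

theorem convex_conicHull {V : Type*} [AddCommMonoid V] [Module ℝ V] (s : Set V) :
    Convex ℝ (ConicHull s) :=
  fun _ hv _ hw _ _ ha hb _ =>
    add_mem_conicHull (smul_mem_conicHull ha hv) (smul_mem_conicHull hb hw)

theorem nonneg_of_mem_conicHull {V : Type*} [AddCommMonoid V] [Module ℝ V] {s : Set V}
    (L : V →ₗ[ℝ] ℝ) (hL : ∀ v ∈ s, 0 ≤ L v) {v : V} (hv : v ∈ ConicHull s) : 0 ≤ L v := by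
  obtain ⟨k, c, z, hc, hz, rfl⟩ := hv
  rw [map_sum]
  exact Finset.sum_nonneg fun j _ => by
    simpa using mul_nonneg (hc j) (hL _ (hz j))

/-- A point outside a closed conic hull is strictly separated from it by a functional which is
nonnegative on the generators. -/
theorem exists_nonneg_neg_of_notMem_conicHull {V : Type*} [NormedAddCommGroup V]
    [NormedSpace ℝ V] {s : Set V} (hs : IsClosed (ConicHull s)) {v : V}
    (hv : v ∉ ConicHull s) : ∃ L : V →ₗ[ℝ] ℝ, (∀ w ∈ s, 0 ≤ L w) ∧ L v < 0 := by
  obtain ⟨L, u, hLv, hLs⟩ := geometric_hahn_banach_point_closed (convex_conicHull s) hs hv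
  have hu : u < 0 := by simpa using hLs 0 (zero_mem_conicHull s)
  refine ⟨L.toLinearMap, fun w hw => ?_, by simpa using hLv.trans hu⟩
  by_contra! h
  have h' : L w < 0 := h
  have hk := hLs _ (smul_mem_conicHull (div_nonneg_of_nonpos hu.le h'.le)
    (subset_conicHull s hw))
  rw [map_smul, smul_eq_mul, div_mul_cancel₀ _ h'.ne] at hk
  exact lt_irrefl _ hk

/-- In finite dimension, a nonempty convex set missing the origin lies in a closed half-space. -/
theorem Convex.exists_ne_zero_nonneg_of_zero_notMem {V : Type*} [NormedAddCommGroup V]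
    [NormedSpace ℝ V] [FiniteDimensional ℝ V] {s : Set V} (hs : Convex ℝ s)
    (hne : s.Nonempty) (h0 : (0 : V) ∉ s) :
    ∃ L : V →ₗ[ℝ] ℝ, L ≠ 0 ∧ ∀ v ∈ s, 0 ≤ L v := by
  by_cases hint : (interior s).Nonempty
  · obtain ⟨L, hL, hLs⟩ := geometric_hahn_banach_of_nonempty_interior_point hs
      (fun h => h0 (interior_subset h)) hint
    refine ⟨-L.toLinearMap, fun h => hL ?_, fun v hv => ?_⟩
    · ext v
      simpa using LinearMap.congr_fun h v
    · simpa using hLs v hv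
  · rw [hs.interior_nonempty_iff_affineSpan_eq_top,
      AffineSubspace.affineSpan_eq_top_iff_vectorSpan_eq_top_of_nonempty ℝ V V hne] at hint
    obtain ⟨L, hL, hLs⟩ := Submodule.exists_le_ker_of_lt_top _ (lt_top_iff_ne_top.2 hint)
    obtain ⟨w, hw⟩ := hne
    have hconst : ∀ v ∈ s, L v = L w := fun v hv => by
      have := hLs (vsub_mem_vectorSpan ℝ hv hw)
      rw [LinearMap.mem_ker, vsub_eq_sub, map_sub] at this
      linarith
    rcases le_total 0 (L w) with h | h
    · exact ⟨L, hL, fun v hv => by rwa [hconst v hv]⟩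
    · exact ⟨-L, neg_ne_zero.2 hL, fun v hv => by
        rw [LinearMap.neg_apply, hconst v hv]; linarith⟩

theorem Convex.zero_mem_of_integral_eq_zero {Ω E : Type*} [MeasurableSpace Ω]
    {P : Measure Ω} [IsProbabilityMeasure P] [NormedAddCommGroup E] [NormedSpace ℝ E]
    [FiniteDimensional ℝ E] {s : Set E} (hs : Convex ℝ s) {Z : Ω → E} (hZ : Integrable Z P)
    (hZs : ∀ᵐ ω ∂P, Z ω ∈ s) (hZ0 : ∫ ω, Z ω ∂P = 0) : (0 : E) ∈ s := by
  suffices H : ∀ (n : ℕ) (W : Submodule ℝ E), Module.finrank ℝ W = n →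
      (∀ᵐ ω ∂P, Z ω ∈ W) → (0 : E) ∈ s from H _ ⊤ rfl (by simp)
  intro n
  induction n using Nat.strong_induction_on with
  | _ n ih =>
    intro W hWn hW
    by_contra h0
    obtain ⟨ω, hω, hωW⟩ := (hZs.and hW).exists
    obtain ⟨L, hL, hLs⟩ :=
      (hs.linear_preimage W.subtype).exists_ne_zero_nonneg_of_zero_notMem
        ⟨⟨Z ω, hωW⟩, hω⟩ (by simpa using h0)
    obtain ⟨M, rfl⟩ := L.exists_extend
    let M' : E →L[ℝ] ℝ := LinearMap.toContinuousLinearMap M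
    have hint : ∫ ω, M' (Z ω) ∂P = 0 := by
      rw [M'.integral_comp_comm hZ, hZ0, map_zero]
    have hnn : 0 ≤ᵐ[P] fun ω => M' (Z ω) := by
      filter_upwards [hZs, hW] with ω h1 h2 using hLs ⟨Z ω, h2⟩ h1
    have hzero := (integral_eq_zero_iff_of_nonneg_ae hnn (M'.integrable_comp hZ)).1 hint
    have hlt : W ⊓ LinearMap.ker M < W := by
      refine inf_lt_left.2 fun hle => hL ?_
      ext w
      exact hle w.2
    refine h0 (ih _ (hWn ▸ Submodule.finrank_lt_finrank_of_lt hlt) _ rfl ?_)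
    filter_upwards [hW, hzero] with ω h1 h2 using ⟨h1, h2⟩

/-- In finite dimension, the expectation of a random vector lies in every convex set containing
the vector almost surely, whether or not that set is closed. -/
theorem Convex.integral_mem_of_finiteDimensional {Ω E : Type*} [MeasurableSpace Ω]
    {P : Measure Ω} [IsProbabilityMeasure P] [NormedAddCommGroup E] [NormedSpace ℝ E]
    [FiniteDimensional ℝ E] {s : Set E} (hs : Convex ℝ s) {Z : Ω → E} (hZ : Integrable Z P)
    (hZs : ∀ᵐ ω ∂P, Z ω ∈ s) : ∫ ω, Z ω ∂P ∈ s := by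
  have h := (hs.translate_preimage_left (∫ ω, Z ω ∂P)).zero_mem_of_integral_eq_zero
    (Z := fun ω => Z ω - ∫ ω, Z ω ∂P) (hZ.sub (integrable_const _))
    (by filter_upwards [hZs] with ω hω; simpa using hω)
    (by simp [integral_sub hZ (integrable_const _)])
  simpa using h

theorem integrable_sum_smul_dirac {A ι : Type*} [Fintype ι] [MeasurableSpace A]
    [MeasurableSingletonClass A] (c : ι → ℝ) (x : ι → A) (φ : A → ℝ) :
    Integrable φ (∑ j, ENNReal.ofReal (c j) • Measure.dirac (x j)) :=
  integrable_finsetSum_measure.2 fun j _ =>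
    (integrable_dirac (by simp)).smul_measure ENNReal.ofReal_ne_top

theorem integral_sum_smul_dirac {A ι : Type*} [Fintype ι] [MeasurableSpace A]
    [MeasurableSingletonClass A] {c : ι → ℝ} (hc : ∀ j, 0 ≤ c j) (x : ι → A) (φ : A → ℝ) :
    ∫ a, φ a ∂(∑ j, ENNReal.ofReal (c j) • Measure.dirac (x j)) = ∑ j, c j * φ (x j) := by
  rw [integral_finsetSum_measure fun j _ =>
    (integrable_dirac (by simp)).smul_measure ENNReal.ofReal_ne_top]
  simp [integral_smul_measure, ENNReal.toReal_ofReal (hc _)]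

/-- Points of the cone above `(1, ḡ)` are values of finitely supported relaxed couplings. -/
theorem mem_OTValues_of_mem_conicHull {N : ℕ} {X : Fin N → Type*}
    [∀ i, MeasurableSpace (X i)] [∀ i, MetricSpace (X i)]
    [∀ i, PolishSpace (X i)] [∀ i, BorelSpace (X i)]
    (μ : ∀ i, Measure (X i)) [∀ i, IsProbabilityMeasure (μ i)]
    (f : (∀ i, X i) → ℝ) (m : Fin N → ℕ) (g : ∀ i, Fin (m i) → X i → ℝ)
    (hg_meas : ∀ i j, Measurable (g i j)) {r : ℝ}
    (hr : ((1 : ℝ), gbar m g μ, r) ∈ ConicHull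
      (Set.range (fun x : ∀ i, X i => ((1 : ℝ), gvec m g x, f x)))) :
    r ∈ OTValues f
      {γ : Measure (∀ i, X i) | IsRelaxedCoupling γ μ (fun i => Set.range (g i))} := by
  obtain ⟨k, c, z, hc, hz, hsum⟩ := hr
  choose x hx using hz
  obtain rfl : (fun j => ((1 : ℝ), gvec m g (x j), f (x j))) = z := funext hx
  have h1 : ∑ j, c j = 1 := by
    simpa [Prod.fst_sum] using (congrArg Prod.fst hsum).symm
  have h2 : ∀ p, ∑ j, c j * gvec m g (x j) p = gbar m g μ p := fun p => by
    simpa [Prod.fst_sum, Prod.snd_sum] using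
      (congrFun (congrArg (fun v => v.2.1) hsum) p).symm
  have h3 : ∑ j, c j * f (x j) = r := by
    simpa [Prod.snd_sum] using (congrArg (fun v => v.2.2) hsum).symm
  have hev : ∀ i, Measurable fun x : ∀ i, X i => x i := fun i => measurable_pi_apply i
  have hprob : IsProbabilityMeasure (∑ j, ENNReal.ofReal (c j) • Measure.dirac (x j)) := by
    constructor
    simp [Measure.finsetSum_apply, ← ENNReal.ofReal_sum_of_nonneg fun j _ => hc j, h1]
  refine ⟨_, ⟨hprob, fun i => ⟨?_, ?_, ?_⟩⟩, integrable_sum_smul_dirac c x f,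
    (integral_sum_smul_dirac hc x f).trans h3⟩
  · exact Measure.isProbabilityMeasure_map (hev i).aemeasurable
  · obtain ⟨y₀⟩ := (μ i).nonempty_of_neZero
    refine ⟨y₀, (integrable_map_measure ?_ (hev i).aemeasurable).2
      (integrable_sum_smul_dirac c x _)⟩
    exact (continuous_const.dist continuous_id).measurable.aestronglyMeasurable
  · rintro _ ⟨j, rfl⟩
    refine ⟨(integrable_map_measure (hg_meas i j).aestronglyMeasurable
      (hev i).aemeasurable).2 (integrable_sum_smul_dirac c x _), ?_⟩
    rw [integral_map (hev i).aemeasurable (hg_meas i j).aestronglyMeasurable,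
      integral_sum_smul_dirac hc]
    exact h2 ⟨i, j⟩

theorem DualFeasible.le_of_mem_OTValues {N : ℕ} {X : Fin N → Type*}
    [∀ i, MeasurableSpace (X i)] [∀ i, MetricSpace (X i)]
    {μ : ∀ i, Measure (X i)} {f : (∀ i, X i) → ℝ} {m : Fin N → ℕ}
    {g : ∀ i, Fin (m i) → X i → ℝ} (hg_meas : ∀ i j, Measurable (g i j))
    {y₀ : ℝ} {y : ((i : Fin N) × Fin (m i)) → ℝ} (hy : DualFeasible m g f y₀ y) {r : ℝ}
    (hr : r ∈ OTValues f
      {γ : Measure (∀ i, X i) | IsRelaxedCoupling γ μ (fun i => Set.range (g i))}) :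
    y₀ + ∑ p, gbar m g μ p * y p ≤ r := by
  obtain ⟨γ, ⟨hγ, hmom⟩, hfγ, rfl⟩ := hr
  have hev : ∀ i, Measurable fun x : ∀ i, X i => x i := fun i => measurable_pi_apply i
  have hint : ∀ p, Integrable (fun x => gvec m g x p) γ := fun p =>
    (((hmom p.1).2.2 _ ⟨p.2, rfl⟩).1).comp_measurable (hev p.1)
  have hval : ∀ p, ∫ x, gvec m g x p ∂γ = gbar m g μ p := fun p => by
    refine Eq.trans ?_ ((hmom p.1).2.2 _ ⟨p.2, rfl⟩).2
    exact (integral_map (hev p.1).aemeasurable (hg_meas p.1 p.2).aestronglyMeasurable).symm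
  have hint' : Integrable (fun x => ∑ p, gvec m g x p * y p) γ :=
    integrable_finsetSum _ fun p _ => (hint p).mul_const _
  calc y₀ + ∑ p, gbar m g μ p * y p
      = ∫ x, (y₀ + ∑ p, gvec m g x p * y p) ∂γ := by
        rw [integral_add (integrable_const _) hint',
          integral_finsetSum _ fun p _ => (hint p).mul_const _]
        simp [integral_mul_const, hval]
    _ ≤ ∫ x, f x ∂γ := integral_mono ((integrable_const _).add hint') hfγ hy

theorem exists_mem_conicHull_of_integrable {N : ℕ} {X : Fin N → Type*}
    [∀ i, MeasurableSpace (X i)] (μ : ∀ i, Measure (X i)) [∀ i, IsProbabilityMeasure (μ i)]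
    (f : (∀ i, X i) → ℝ) (m : Fin N → ℕ) (g : ∀ i, Fin (m i) → X i → ℝ)
    (hg_int : ∀ i j, Integrable (g i j) (μ i)) :
    ∃ c : ℝ, ((1 : ℝ), gbar m g μ, c) ∈ ConicHull
      (Set.range (fun x : ∀ i, X i => ((1 : ℝ), gvec m g x, f x))) := by
  set C := ConicHull (Set.range (fun x : ∀ i, X i => ((1 : ℝ), gvec m g x, f x)))
  have hs : Convex ℝ {v : ((i : Fin N) × Fin (m i)) → ℝ | ∃ c : ℝ, ((1 : ℝ), v, c) ∈ C} := by
    rintro v ⟨a, ha⟩ w ⟨b, hb⟩ s t hs ht hst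
    refine ⟨s • a + t • b, ?_⟩
    simpa [hst] using convex_conicHull _ ha hb hs ht hst
  have hint : ∀ p, Integrable (fun x => gvec m g x p) (Measure.pi μ) := fun p =>
    integrable_comp_eval (hg_int p.1 p.2)
  have h := hs.integral_mem_of_finiteDimensional (P := Measure.pi μ) (Z := gvec m g)
    (Integrable.of_eval hint)
    (Filter.Eventually.of_forall fun x => ⟨f x, subset_conicHull _ ⟨x, rfl⟩⟩)
  have hval : ∫ x, gvec m g x ∂(Measure.pi μ) = gbar m g μ := by
    ext p
    rw [eval_integral hint]
    exact integral_comp_eval (hg_int p.1 p.2).aestronglyMeasurable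
  rwa [hval] at h

theorem linearMap_prod_pi_apply {ι : Type*} [Fintype ι]
    (L : ℝ × (ι → ℝ) × ℝ →ₗ[ℝ] ℝ) :
    ∃ (a : ℝ) (b : ι → ℝ) (t : ℝ),
      ∀ (u : ℝ) (v : ι → ℝ) (w : ℝ), L (u, v, w) = u * a + ∑ p, v p * b p + w * t := by
  classical
  refine ⟨L (1, 0, 0), fun p => L (0, Pi.single p 1, 0), L (0, 0, 1), fun u v w => ?_⟩
  have hv := ((L ∘ₗ LinearMap.inr ℝ ℝ _) ∘ₗ LinearMap.inl ℝ (ι → ℝ) ℝ).pi_apply_eq_sum_univ v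
  have huvw : (u, v, w) = u • ((1 : ℝ), (0 : ι → ℝ), (0 : ℝ)) + (0, v, 0) + w • (0, 0, 1) := by
    simp
  rw [huvw, map_add, map_add, map_smul, map_smul, smul_eq_mul, smul_eq_mul]
  congr 2
  refine hv.trans (Finset.sum_congr rfl fun p _ => ?_)
  have hp : (fun j => if p = j then (1 : ℝ) else 0) = Pi.single p 1 := by
    ext j
    simp [Pi.single_apply, eq_comm]
  rw [hp]
  rfl

/-- **Theorem 2.12 (ii) under (SD2)**: if the dual LSIP problem is feasible and the cone
`C = cone({(1, g(x), f(x)) : x ∈ X}) ⊆ ℝ^{m+2}` is closed, then strong duality holds: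
the dual supremum equals the primal infimum. -/
theorem lsip_strong_duality_closed_cone {N : ℕ} {X : Fin N → Type*}
    [∀ i, MeasurableSpace (X i)] [∀ i, MetricSpace (X i)]
    [∀ i, PolishSpace (X i)] [∀ i, BorelSpace (X i)]
    (μ : ∀ i, Measure (X i)) (hμprob : ∀ i, IsProbabilityMeasure (μ i))
    (hμP1 : ∀ i, HasFiniteFirstMoment (μ i))
    (f : (∀ i, X i) → ℝ)
    (hf_lsc : LowerSemicontinuous f)
    (hf_lb : ∃ h : ∀ i, X i → ℝ, (∀ i, UpperSemicontinuous (h i)) ∧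
      (∀ i, Integrable (h i) (μ i)) ∧ ∀ x : ∀ i, X i, (∑ i, h i (x i)) ≤ f x)
    (m : Fin N → ℕ) (g : ∀ i, Fin (m i) → X i → ℝ)
    (hg_meas : ∀ i j, Measurable (g i j))
    (hg_int : ∀ i j, Integrable (g i j) (μ i))
    (hfeas : ∃ (y₀ : ℝ) (y : ((i : Fin N) × Fin (m i)) → ℝ), DualFeasible m g f y₀ y)
    (hclosed : IsClosed (ConicHull
      (Set.range (fun x : ∀ i, X i => ((1 : ℝ), gvec m g x, f x))))) :
    sSup {r : ℝ | ∃ (y₀ : ℝ) (y : ((i : Fin N) × Fin (m i)) → ℝ),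
        DualFeasible m g f y₀ y ∧ y₀ + ∑ p, gbar m g μ p * y p = r} =
      sInf (OTValues f
        {γ : Measure (∀ i, X i) | IsRelaxedCoupling γ μ (fun i => Set.range (g i))}) := by
  set D := {r : ℝ | ∃ (y₀ : ℝ) (y : ((i : Fin N) × Fin (m i)) → ℝ),
    DualFeasible m g f y₀ y ∧ y₀ + ∑ p, gbar m g μ p * y p = r} with hD
  set O := OTValues f
    {γ : Measure (∀ i, X i) | IsRelaxedCoupling γ μ (fun i => Set.range (g i))}
  have hweak : ∀ d ∈ D, ∀ r ∈ O, d ≤ r := by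
    rintro _ ⟨y₀, y, hy, rfl⟩ r hr
    exact hy.le_of_mem_OTValues hg_meas hr
  have hDne : D.Nonempty := by
    obtain ⟨y₀, y, hy⟩ := hfeas
    exact ⟨_, y₀, y, hy, rfl⟩
  obtain ⟨c, hc⟩ := exists_mem_conicHull_of_integrable μ f m g hg_int
  have hcO : c ∈ O := mem_OTValues_of_mem_conicHull μ f m g hg_meas hc
  have hDbdd : BddAbove D := ⟨c, fun d hd => hweak d hd c hcO⟩
  have hObdd : BddBelow O := hDne.imp fun d hd r hr => hweak d hd r hr
  refine le_antisymm (csSup_le hDne fun d hd => le_csInf ⟨c, hcO⟩ (hweak d hd))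
    (csInf_le hObdd (mem_OTValues_of_mem_conicHull μ f m g hg_meas ?_))
  by_contra hnot
  obtain ⟨L, hL, hneg⟩ := exists_nonneg_neg_of_notMem_conicHull hclosed hnot
  have hLc := nonneg_of_mem_conicHull L hL hc
  obtain ⟨a, b, t, hLabt⟩ := linearMap_prod_pi_apply L
  rw [hLabt] at hneg hLc
  have hsup : sSup D ≤ c := csSup_le hDne fun d hd => hweak d hd c hcO
  have ht : 0 < t := by
    by_contra! ht
    nlinarith [mul_nonneg (sub_nonneg.2 hsup) (neg_nonneg.2 ht)]
  have hdiv : ∀ v : ((i : Fin N) × Fin (m i)) → ℝ,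
      -a / t + ∑ p, v p * (-b p / t) = -(a + ∑ p, v p * b p) / t := fun v => by
    simp only [mul_div_assoc', mul_neg, ← Finset.sum_div, Finset.sum_neg_distrib]
    ring
  have hle : -(a + ∑ p, gbar m g μ p * b p) / t ≤ sSup D := by
    refine le_csSup hDbdd ⟨-a / t, fun p => -b p / t, fun x => ?_, hdiv _⟩
    have hx := hL _ ⟨x, rfl⟩
    rw [hLabt] at hx
    rw [hdiv, div_le_iff₀ ht]
    linarith
  rw [div_le_iff₀ ht] at hle
  linarith

end
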